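/- For a single activity a scheduled at start time s with s_min ≤ s ≤ s_max, the actual overlap of the execution interval [s, s+p) with [t1, t2) has length at least MI(t1,t2,a); that is, the length of [max(s,t1), min(s+p, t2)) (taken as max(0, min(s+p,t2) - max(s,t1))) is at least MI(t1,t2,a). -/

import Mathlib

/-- Minimum intersection of an activity (sMin, sMax, p) with interval [t1,t2]. -/
noncomputable def MI (sMin sMax p t1 t2 : ℝ) : ℝ :=
  max 0 (min (min p (t2 - t1)) (min (sMin + p - t1) (t2 - sMax)))

/-- Left derivative. -/
noncomputable def leftD (f : ℝ → ℝ) (x : ℝ) : ℝ := derivWithin f (Set.Iio x) x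

/-- Right derivative. -/
noncomputable def rightD (f : ℝ → ℝ) (x : ℝ) : ℝ := derivWithin f (Set.Ioi x) x

theorem mi_le_overlap (sMin sMax p t1 t2 s : ℝ)
    (hs : sMin ≤ sMax) (hp : 0 ≤ p) (ht : t1 ≤ t2)
    (h1 : sMin ≤ s) (h2 : s ≤ sMax) :
    MI sMin sMax p t1 t2 ≤ max 0 (min (s + p) t2 - max s t1) := by
  unfold MI
  apply max_le_max le_rfl
  have a1 := min_le_left (min p (t2 - t1)) (min (sMin + p - t1) (t2 - sMax))
  have a2 := min_le_right (min p (t2 - t1)) (min (sMin + p - t1) (t2 - sMax))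
  obtain ⟨b1, b2⟩ := le_min_iff.1 a1
  obtain ⟨b3, b4⟩ := le_min_iff.1 a2
  rcases min_choice (s + p) t2 with h | h <;> rcases max_choice s t1 with h' | h' <;>
    rw [h, h'] <;> linarith
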